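/- Let Λ ⊆ ℂ be a lattice and let s ∈ ℂ satisfy ns ∉ Λ for every integer n ≥ 1. Let α ∈ ℂ and let h be an elliptic function for Λ that is analytic on ℂ ∖ ((α+Λ) ∪ (α+s+Λ)) and has at worst simple poles at points of (α+Λ) ∪ (α+s+Λ), i.e. z ↦ (z−β)·h(z) extends analytically to β for every β ∈ (α+Λ) ∪ (α+s+Λ). Then the derivative h' is elliptically summable. -/

import Mathlib

open Filter Topology Set

/-- The Weierstrass zeta function of a lattice `L ⊆ ℂ`. -/
noncomputable def wzeta (L : Set ℂ) (z : ℂ) : ℂ :=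
  1 / z + ∑' l : ↥(L \ {0}), (1 / (z - (l : ℂ)) + 1 / (l : ℂ) + z / (l : ℂ) ^ 2)

/-- `L` is a lattice in `ℂ`. -/
def IsLattice (L : Set ℂ) : Prop :=
  ∃ ω₁ ω₂ : ℂ, LinearIndependent ℝ ![ω₁, ω₂] ∧
    L = {z : ℂ | ∃ m n : ℤ, z = (m : ℂ) * ω₁ + (n : ℂ) * ω₂}

/-- `F` extends analytically to the point `α`. -/
def ExtAnalyticAt (F : ℂ → ℂ) (α : ℂ) : Prop :=
  ∃ g : ℂ → ℂ, AnalyticAt ℂ g α ∧ ∀ᶠ z in 𝓝[≠] α, F z = g z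

/-- `f` is an elliptic function for the lattice `L`: meromorphic on `ℂ` and `L`-periodic. -/
def IsElliptic (L : Set ℂ) (f : ℂ → ℂ) : Prop :=
  MeromorphicOn f Set.univ ∧
    ∀ lam ∈ L, ∀ z : ℂ, AnalyticAt ℂ f z → f (z + lam) = f z

/-- `c : ℕ → ℂ` is the family of principal part coefficients of `f` at `α`
(`c k` is the coefficient of `1/(z-α)^k`; `c 0` is irrelevant and set to `0`). -/
def IsPrincPart (f : ℂ → ℂ) (α : ℂ) (c : ℕ → ℂ) : Prop :=
  c 0 = 0 ∧ (Function.support c).Finite ∧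
    ExtAnalyticAt (fun z => f z - ∑ᶠ k : ℕ, c k / (z - α) ^ k) α

/-- `R` is a pinning: `(r, n, λ) ↦ r + n s + λ` is a bijection from `R × ℤ × L` onto `ℂ`. -/
def IsPinning (L : Set ℂ) (s : ℂ) (R : Set ℂ) : Prop :=
  ∀ z : ℂ, ∃! p : ℂ × ℤ × ℂ, p.1 ∈ R ∧ p.2.2 ∈ L ∧ z = p.1 + (p.2.1 : ℂ) * s + p.2.2


/-- `f` is elliptically summable: `f = τ(g) − g` for some elliptic `g`,
where `τ(g)(z) = g(z+s)`. -/
def EllSummable (L : Set ℂ) (s : ℂ) (f : ℂ → ℂ) : Prop :=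
  ∃ g : ℂ → ℂ, IsElliptic L g ∧
    ∀ z : ℂ, AnalyticAt ℂ g z → AnalyticAt ℂ g (z + s) → f z = g (z + s) - g z

namespace PeriodPair

variable (P : PeriodPair)

/-- The Weierstrass zeta function with its polar term `1 / z` removed. -/
noncomputable def zetaReg (z : ℂ) : ℂ :=
  ∑' l : P.lattice, if l.1 = 0 then 0 else (1 / (z - l) + 1 / l + z / (l : ℂ) ^ 2)

/-- The Weierstrass zeta function of a period pair. -/
noncomputable def zeta (z : ℂ) : ℂ := 1 / z + P.zetaReg z

lemma zeta_bound (r : ℝ) (hr : 0 < r) (z : ℂ) (hz : ‖z‖ < r) (l : ℂ) (h : 2 * r ≤ ‖l‖) :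
    ‖1 / (z - l) + 1 / l + z / l ^ 2‖ ≤ 2 * r ^ 2 * ‖l‖ ^ (-3 : ℝ) := by
  have hl : 0 < ‖l‖ := by linarith
  have hl0 : l ≠ 0 := norm_pos_iff.mp hl
  have hzl : z - l ≠ 0 := by
    intro e
    obtain rfl := sub_eq_zero.mp e
    linarith
  have h1 : ‖l‖ / 2 ≤ ‖z - l‖ := by
    rw [norm_sub_rev]
    exact .trans (by linarith) (norm_sub_norm_le l z)
  calc
    _ = ‖z ^ 2 / (l ^ 2 * (z - l))‖ := by
      congr 1
      field_simp
      ring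
    _ = ‖z‖ ^ 2 / (‖l‖ ^ 2 * ‖z - l‖) := by simp
    _ ≤ r ^ 2 / (‖l‖ ^ 2 * (‖l‖ / 2)) := by gcongr
    _ = 2 * r ^ 2 / ‖l‖ ^ 3 := by field
    _ = _ := by norm_cast

lemma hasSumLocallyUniformly_zetaReg :
    HasSumLocallyUniformly
      (fun (l : P.lattice) (z : ℂ) ↦
        if l.1 = 0 then 0 else (1 / (z - l) + 1 / l + z / (l : ℂ) ^ 2))
      P.zetaReg := by
  refine P.hasSumLocallyUniformly_aux (u := (2 * · ^ 2 * ‖·‖ ^ (-3 : ℝ))) _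
    (fun _ _ ↦ (ZLattice.summable_norm_rpow _ _ (by simp; norm_num)).mul_left _) fun r hr ↦
    Filter.eventually_atTop.mpr ⟨2 * r, ?_⟩
  rintro _ h s hs l rfl
  split_ifs
  · simpa using! show 0 ≤ 2 * r ^ 2 * (‖l.1‖ ^ 3)⁻¹ by positivity
  · exact zeta_bound r hr s hs l h

lemma hasDerivAt_zetaReg {z : ℂ} (hz : z ∈ ((P.lattice : Set ℂ) \ {0})ᶜ) :
    HasDerivAt P.zetaReg (-P.weierstrassPExcept 0 z) z := by
  have hterm : ∀ (l : P.lattice), ∀ w ∈ ((P.lattice : Set ℂ) \ {0})ᶜ,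
      HasDerivAt (fun z : ℂ ↦ if l.1 = 0 then 0 else (1 / (z - l) + 1 / l + z / (l : ℂ) ^ 2))
        (-(if l.1 = 0 then 0 else (1 / (w - l) ^ 2 - 1 / (l : ℂ) ^ 2))) w := by
    intro l w hw
    split_ifs with hl
    · simpa using hasDerivAt_const w (0 : ℂ)
    have hwl : w - l ≠ 0 := by
      intro e
      obtain rfl := sub_eq_zero.mp e
      exact hw ⟨l.2, hl⟩
    have h1 := ((((hasDerivAt_id w).sub_const (l : ℂ)).inv hwl).add_const (1 / (l : ℂ))).add
      ((hasDerivAt_id w).div_const ((l : ℂ) ^ 2))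
    convert! h1 using 1
    · ext
      simp
    · simp
      ring
  have hloc := P.hasSumLocallyUniformly_zetaReg.tendstoLocallyUniformlyOn
    (s := ((P.lattice : Set ℂ) \ {0})ᶜ)
  have hd : ∀ s : Finset P.lattice, DifferentiableOn ℂ (fun z ↦ ∑ l ∈ s,
      if l.1 = 0 then 0 else (1 / (z - l) + 1 / l + z / (l : ℂ) ^ 2))
      ((P.lattice : Set ℂ) \ {0})ᶜ := fun s ↦
    .fun_sum fun l _ w hw ↦ (hterm l w hw).differentiableAt.differentiableWithinAt
  have hdiff := (hloc.differentiableOn (.of_forall hd) P.isOpen_compl_lattice_sdiff).differentiableAt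
    (P.isOpen_compl_lattice_sdiff.mem_nhds hz)
  have hlim := (hloc.deriv (.of_forall hd) P.isOpen_compl_lattice_sdiff).tendsto_at hz
  have hlim' := (P.hasSum_weierstrassPExcept 0 z).neg
  have : deriv P.zetaReg z = -P.weierstrassPExcept 0 z := by
    refine tendsto_nhds_unique hlim (hlim'.congr fun s ↦ ?_)
    exact (HasDerivAt.fun_sum fun l _ ↦ hterm l z hz).deriv.symm
  exact this ▸ hdiff.hasDerivAt

lemma analyticAt_zetaReg_zero : AnalyticAt ℂ P.zetaReg 0 :=
  DifferentiableOn.analyticAt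
    (fun _ hz ↦ (P.hasDerivAt_zetaReg hz).differentiableAt.differentiableWithinAt)
    (P.isOpen_compl_lattice_sdiff.mem_nhds (by simp))

lemma hasDerivAt_zeta {z : ℂ} (hz : z ∉ P.lattice) :
    HasDerivAt P.zeta (-P.weierstrassP z) z := by
  have hz0 : z ≠ 0 := by
    rintro rfl
    exact hz (zero_mem _)
  have h1 := (hasDerivAt_inv hz0).add (P.hasDerivAt_zetaReg (z := z) fun h ↦ hz h.1)
  convert! h1 using 1
  · ext
    simp [zeta]
  · have h2 := P.weierstrassPExcept_add 0 z
    simp at h2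
    rw [← h2]
    ring

lemma analyticAt_zeta {z : ℂ} (hz : z ∉ P.lattice) : AnalyticAt ℂ P.zeta z :=
  DifferentiableOn.analyticAt (s := (P.lattice : Set ℂ)ᶜ)
    (fun _ hw ↦ (P.hasDerivAt_zeta hw).differentiableAt.differentiableWithinAt)
    (P.isClosed_lattice.isOpen_compl.mem_nhds hz)

lemma zeta_neg (z : ℂ) : P.zeta (-z) = -P.zeta z := by
  have : P.zetaReg (-z) = -P.zetaReg z := by
    simp only [zetaReg]
    rw [← (Equiv.neg P.lattice).tsum_eq, ← tsum_neg]
    congr with l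
    by_cases hl : l.1 = 0
    · simp [hl]
    · have : 1 / (-z + l.1) = -(1 / (z - l.1)) := by
        rw [← div_neg, neg_sub, neg_add_eq_sub]
      simp only [Equiv.neg_apply, NegMemClass.coe_neg, neg_eq_zero, hl, if_false, sub_neg_eq_add,
        this]
      ring
  rw [zeta, zeta, this]
  ring

lemma countable_lattice : (P.lattice : Set ℂ).Countable :=
  Set.countable_coe_iff.mp (P.latticeEquivProd.toEquiv.countable_iff.mpr inferInstance)

lemma isPreconnected_compl_lattice : IsPreconnected (P.lattice : Set ℂ)ᶜ :=
  (P.countable_lattice.isConnected_compl_of_one_lt_rank (by simp)).isPreconnected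

lemma exists_zeta_add_coe (l : P.lattice) :
    ∃ η : ℂ, ∀ z ∉ P.lattice, P.zeta (z + l) = P.zeta z + η := by
  have hd : ∀ z ∉ P.lattice, HasDerivAt (fun z ↦ P.zeta (z + l) - P.zeta z) 0 z := by
    intro z hz
    have hzl : z + l ∉ P.lattice := fun h ↦ hz (by simpa using sub_mem h l.2)
    have h1 := ((P.hasDerivAt_zeta hzl).comp_add_const z (l : ℂ)).sub (P.hasDerivAt_zeta hz)
    simpa using! h1
  obtain ⟨η, hη⟩ := P.isClosed_lattice.isOpen_compl.exists_is_const_of_deriv_eq_zero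
    P.isPreconnected_compl_lattice
    (fun z hz ↦ (hd z hz).differentiableAt.differentiableWithinAt) (fun z hz ↦ (hd z hz).deriv)
  exact ⟨η, fun z hz ↦ by rw [← hη z hz]; ring⟩

end PeriodPair

lemma AnalyticAt.extAnalyticAt {F : ℂ → ℂ} {p : ℂ} (hF : AnalyticAt ℂ F p) :
    ExtAnalyticAt F p :=
  ⟨F, hF, .of_forall fun _ ↦ rfl⟩

lemma ExtAnalyticAt.sub {F G : ℂ → ℂ} {p : ℂ} (hF : ExtAnalyticAt F p) (hG : ExtAnalyticAt G p) :
    ExtAnalyticAt (fun z ↦ F z - G z) p := by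
  obtain ⟨f, hf, hFf⟩ := hF
  obtain ⟨g, hg, hGg⟩ := hG
  refine ⟨fun z ↦ f z - g z, hf.sub hg, ?_⟩
  filter_upwards [hFf, hGg] with z h1 h2
  rw [h1, h2]

lemma ExtAnalyticAt.congr {F G : ℂ → ℂ} {p : ℂ} (hF : ExtAnalyticAt F p)
    (h : ∀ᶠ z in 𝓝[≠] p, G z = F z) : ExtAnalyticAt G p := by
  obtain ⟨f, hf, hFf⟩ := hF
  refine ⟨f, hf, ?_⟩
  filter_upwards [hFf, h] with z h1 h2
  rw [h2, h1]

lemma tendsto_add_const_nhdsNE (p l : ℂ) : Tendsto (fun z ↦ z + l) (𝓝[≠] p) (𝓝[≠] (p + l)) :=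
  tendsto_nhdsWithin_of_tendsto_nhds_of_eventually_within _
    ((continuous_add_const l).continuousAt.mono_left nhdsWithin_le_nhds)
    (eventually_mem_nhdsWithin.mono fun z hz ↦ by simpa using! hz)

lemma ExtAnalyticAt.comp_add_const {F : ℂ → ℂ} {p l : ℂ} (hF : ExtAnalyticAt F (p + l)) :
    ExtAnalyticAt (fun z ↦ F (z + l)) p := by
  obtain ⟨f, hf, hFf⟩ := hF
  exact ⟨fun z ↦ f (z + l), hf.fun_comp (f := fun z ↦ z + l) (by fun_prop),
    (tendsto_add_const_nhdsNE p l).eventually hFf⟩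

/-- A simple pole times a zero is removable. -/
lemma ExtAnalyticAt.mul_of_eq_zero {F G : ℂ → ℂ} {p : ℂ}
    (hF : ExtAnalyticAt (fun z ↦ (z - p) * F z) p) (hG : AnalyticAt ℂ G p) (hp : G p = 0) :
    ExtAnalyticAt (fun z ↦ F z * G z) p := by
  obtain ⟨f, hf, hFf⟩ := hF
  obtain ⟨q, hq⟩ := hG
  refine ⟨fun z ↦ f z * dslope G p z, hf.mul hq.has_fpower_series_dslope_fslope.analyticAt, ?_⟩
  filter_upwards [hFf, eventually_mem_nhdsWithin] with z h1 h2
  have hz : z - p ≠ 0 := sub_ne_zero.mpr h2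
  rw [← h1, dslope_of_ne _ h2, slope_def_field, hp]
  field_simp
  ring

/-- A function with at worst a simple pole differs from its polar part by an analytic function. -/
lemma ExtAnalyticAt.exists_residue {F : ℂ → ℂ} {p : ℂ}
    (hF : ExtAnalyticAt (fun z ↦ (z - p) * F z) p) :
    ∃ c : ℂ, ExtAnalyticAt (fun z ↦ F z - c / (z - p)) p := by
  obtain ⟨f, ⟨q, hq⟩, hFf⟩ := hF
  refine ⟨f p, dslope f p, hq.has_fpower_series_dslope_fslope.analyticAt, ?_⟩
  filter_upwards [hFf, eventually_mem_nhdsWithin] with z h1 h2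
  have hz : z - p ≠ 0 := sub_ne_zero.mpr h2
  rw [dslope_of_ne _ h2, slope_def_field, ← h1]
  field_simp

lemma exists_differentiable_of_extAnalyticAt {F : ℂ → ℂ} (hF : ∀ p, ExtAnalyticAt F p) :
    ∃ E : ℂ → ℂ, Differentiable ℂ E ∧ ∀ p, ContinuousAt F p → E p = F p := by
  choose g hg hFg using hF
  have key : ∀ p, (fun z ↦ g z z) =ᶠ[𝓝 p] g p := by
    intro p
    have h1 : ∀ᶠ z in 𝓝 p, AnalyticAt ℂ (g p) z := (hg p).eventually_analyticAt
    have h2 := eventually_eventually_nhdsWithin.mpr (hFg p)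
    have h3 : ∀ᶠ z in 𝓝[≠] p, g z z = g p z := by
      filter_upwards [h1.filter_mono nhdsWithin_le_nhds, h2, eventually_mem_nhdsWithin]
        with z hz1 hz2 hz3
      have hz2' : ∀ᶠ w in 𝓝[≠] z, F w = g p w := by
        have : ∀ᶠ w in 𝓝 z, F w = g p w := by
          rwa [(isOpen_compl_singleton).nhdsWithin_eq hz3] at hz2
        exact this.filter_mono nhdsWithin_le_nhds
      have : g z =ᶠ[𝓝[≠] z] g p := by
        filter_upwards [hFg z, hz2'] with w a b
        rw [← a, b]
      exact (((hg z).continuousAt.eventuallyEq_nhds_iff_eventuallyEq_nhdsNE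
        hz1.continuousAt).mp this).self_of_nhds
    rw [eventually_nhdsWithin_iff] at h3
    filter_upwards [h3] with z hz
    by_cases hzp : z = p
    · rw [hzp]
    · exact hz hzp
  refine ⟨fun z ↦ g z z, fun p ↦ ((hg p).congr (key p).symm).differentiableAt, fun p hp ↦ ?_⟩
  have : F =ᶠ[𝓝[≠] p] g p := hFg p
  exact ((hp.eventuallyEq_nhds_iff_eventuallyEq_nhdsNE
    (hg p).continuousAt).mp this).self_of_nhds.symm

namespace PeriodPair

variable (P : PeriodPair)

lemma eventually_sub_notMem_lattice (a p : ℂ) : ∀ᶠ z in 𝓝[≠] p, z - a ∉ P.lattice := by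
  have h1 := tendsto_add_const_nhdsNE p (-a)
  have h2 : ∀ᶠ z in 𝓝[≠] (p + -a), z ∉ P.lattice := by
    filter_upwards [mem_nhdsWithin_of_mem_nhds (P.compl_lattice_sdiff_singleton_mem_nhds (p + -a)),
      eventually_mem_nhdsWithin] with z h h' hz
    exact h ⟨hz, h'⟩
  simpa only [sub_eq_add_neg] using h1.eventually h2

lemma apply_eq_apply_of_periodic {E : ℂ → ℂ} (hE : Differentiable ℂ E)
    (hper : ∀ l ∈ P.lattice, ∀ z, E (z + l) = E z) (z w : ℂ) : E z = E w :=
  hE.apply_eq_apply_of_bounded (IsZLattice.isCompact_range_of_periodic P.lattice _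
    hE.continuous fun z l hl ↦ hper l hl z).isBounded z w

lemma exists_affine_of_quasiperiodic {E : ℂ → ℂ} (hE : Differentiable ℂ E)
    (hper : ∀ l ∈ P.lattice, ∃ κ, ∀ z, E (z + l) = E z + κ) :
    ∃ K B : ℂ, ∀ z, E z = K * z + B := by
  have hd : ∀ z, deriv E z = deriv E 0 := by
    refine fun z ↦ P.apply_eq_apply_of_periodic (hE.deriv) (fun l hl z ↦ ?_) z 0
    obtain ⟨κ, hκ⟩ := hper l hl
    rw [← deriv_comp_add_const, funext hκ, deriv_add_const]
  refine ⟨deriv E 0, E 0, fun z ↦ ?_⟩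
  have hK : ∀ z, HasDerivAt (fun z ↦ E z - deriv E 0 * z) 0 z := by
    intro z
    have := (hE z).hasDerivAt.sub ((hasDerivAt_id z).const_mul (deriv E 0))
    simpa [hd z] using! this
  have := is_const_of_deriv_eq_zero (fun z ↦ (hK z).differentiableAt) (fun z ↦ (hK z).deriv) z 0
  simp only [mul_zero, sub_zero] at this
  rw [← this]
  ring

/-- An elliptic function of the form `e * ζ(z) + K * z` has no pole. -/
lemma eq_zero_of_zeta_add_linear_periodic {e K : ℂ}
    (hper : ∀ l ∈ P.lattice, ∀ z ∉ P.lattice,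
      e * P.zeta (z + l) + K * (z + l) = e * P.zeta z + K * z) : e = 0 := by
  set f : ℂ → ℂ := fun z ↦ e * P.zeta z + K * z with hf
  replace hper : ∀ l ∈ P.lattice, ∀ z ∉ P.lattice, f (z + l) = f z := hper
  have hodd : ∀ z, f (-z) = -f z := fun z ↦ by simp only [hf, zeta_neg]; ring
  have han : ∀ z ∉ P.lattice, AnalyticAt ℂ f z := fun z hz ↦ by
    have := P.analyticAt_zeta hz
    fun_prop
  have hhalf : ∀ w, w + w ∈ P.lattice → w ∉ P.lattice → f w = 0 := by
    intro w h2 hw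
    have h1 := hper _ h2 (-w) (by simpa using hw)
    rw [hodd, neg_add_cancel_left] at h1
    exact self_eq_neg.mp h1
  have hpole : ∀ q ∈ P.lattice, ∃ g : ℂ → ℂ, AnalyticAt ℂ g q ∧ g q = e ∧
      ∀ᶠ z in 𝓝[≠] q, (z - q) * f z = g z := by
    intro q hq
    refine ⟨fun z ↦ e + (z - q) * (e * P.zetaReg (z - q) + K * (z - q)), ?_, by simp, ?_⟩
    · have : AnalyticAt ℂ (fun z ↦ P.zetaReg (z - q)) q :=
        AnalyticAt.fun_comp (f := fun z ↦ z - q) (by simpa using P.analyticAt_zetaReg_zero)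
          (by fun_prop)
      fun_prop
    · filter_upwards [P.eventually_sub_notMem_lattice q q, eventually_mem_nhdsWithin] with z hz hzq
      have hzq' : z - q ≠ 0 := sub_ne_zero.mpr hzq
      have := hper q hq _ hz
      rw [sub_add_cancel] at this
      rw [this]
      simp only [hf, zeta]
      field_simp
      ring
  have hmem : ∀ x y : ℚ, (x * P.ω₁ + y * P.ω₂ ∈ P.lattice ↔ x.den = 1 ∧ y.den = 1) := fun x y ↦
    P.mul_ω₁_add_mul_ω₂_mem_lattice
  set a := P.ω₁ / 2 with ha
  set b := P.ω₂ / 2 with hb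
  have haL : a ∉ P.lattice := P.ω₁_div_two_notMem_lattice
  have hbL : b ∉ P.lattice := P.ω₂_div_two_notMem_lattice
  have haa : a + a ∈ P.lattice := by simpa [ha] using P.ω₁_mem_lattice
  have hbb : b + b ∈ P.lattice := by simpa [hb] using P.ω₂_mem_lattice
  have hbaL : b + a ∉ P.lattice := by
    have := (hmem (1 / 2) (1 / 2)).not.mpr (by norm_num)
    convert this using 2
    push_cast
    ring
  have hshift : ∀ z, z + a ∉ P.lattice → AnalyticAt ℂ (fun z ↦ f (z + a)) z := fun z hz ↦
    (han _ hz).fun_comp (f := fun z ↦ z + a) (by fun_prop)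
  have hext : ∀ q, ExtAnalyticAt (fun z ↦ f z * f (z + a)) q := by
    intro q
    by_cases hq : q ∈ P.lattice
    · have hqa : q + a ∉ P.lattice := fun h ↦ haL (by simpa using sub_mem h hq)
      obtain ⟨g, hg, -, hfg⟩ := hpole q hq
      refine ExtAnalyticAt.mul_of_eq_zero ⟨g, hg, hfg⟩ (hshift q hqa) ?_
      rw [add_comm, hper q hq a haL, hhalf a haa haL]
    by_cases hqa : q + a ∈ P.lattice
    · obtain ⟨g, hg, -, hfg⟩ := hpole _ hqa
      have h1 : ExtAnalyticAt (fun z ↦ (z - q) * f (z + a)) q := by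
        have := ExtAnalyticAt.comp_add_const (F := fun z ↦ (z - (q + a)) * f z) ⟨g, hg, hfg⟩
        simpa using this
      have hq2 : q + q ∈ P.lattice := by
        convert sub_mem (add_mem hqa hqa) haa using 1
        ring
      simpa only [mul_comm] using h1.mul_of_eq_zero (han q hq) (hhalf q hq2 hq)
    · exact ((han q hq).mul (hshift q hqa)).extAnalyticAt
  obtain ⟨E, hE, hEf⟩ := exists_differentiable_of_extAnalyticAt hext
  replace hEf : ∀ z ∉ P.lattice, z + a ∉ P.lattice → E z = f z * f (z + a) := fun z hz hza ↦
    hEf z ((han z hz).mul (hshift z hza)).continuousAt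
  have hEper : ∀ l ∈ P.lattice, ∀ z, E (z + l) = E z := by
    intro l hl z
    have h1 : (fun z ↦ E (z + l)) =ᶠ[𝓝[≠] z] E := by
      filter_upwards [P.eventually_sub_notMem_lattice 0 z, P.eventually_sub_notMem_lattice (-a) z]
        with w hw hwa
      rw [sub_zero] at hw
      rw [sub_neg_eq_add] at hwa
      have hwl : w + l ∉ P.lattice := fun h ↦ hw (by simpa using sub_mem h hl)
      have hwal : w + l + a ∉ P.lattice := fun h ↦ hwa (by
        convert sub_mem h hl using 1
        ring)
      rw [hEf _ hwl hwal, hEf _ hw hwa, hper l hl w hw, add_right_comm, hper l hl _ hwa]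
    have hc : ContinuousAt (fun z ↦ E (z + l)) z :=
      (hE.continuous.comp (continuous_add_const l)).continuousAt
    exact ((hc.eventuallyEq_nhds_iff_eventuallyEq_nhdsNE
      hE.continuous.continuousAt).mp h1).self_of_nhds
  have hE0 : ∀ z, E z = 0 := fun z ↦ by
    rw [P.apply_eq_apply_of_periodic hE hEper z b, hEf b hbL hbaL, hhalf b hbb hbL, zero_mul]
  by_contra he
  obtain ⟨g, hg, hg0, hfg⟩ := hpole 0 (zero_mem _)
  have hne : ∀ᶠ z in 𝓝[≠] (0 : ℂ), f z ≠ 0 ∧ z ∉ P.lattice ∧ z - (-a) ∉ P.lattice := by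
    filter_upwards [hfg, (hg.continuousAt.eventually_ne (hg0 ▸ he)).filter_mono nhdsWithin_le_nhds,
      P.eventually_sub_notMem_lattice 0 0, P.eventually_sub_notMem_lattice (-a) 0]
      with z h1 h2 h3 h4
    refine ⟨fun h ↦ h2 ?_, by simpa using h3, h4⟩
    rw [← h1, h, mul_zero]
  have hzero : ∀ᶠ z in 𝓝[≠] a, f z = 0 := by
    have h1 := tendsto_add_const_nhdsNE a (-a)
    rw [add_neg_cancel] at h1
    filter_upwards [h1.eventually hne] with z hz
    have h2 := hEf (z + -a) hz.2.1 (by simpa using hz.2.2)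
    rw [hE0, neg_add_cancel_right] at h2
    exact (mul_eq_zero.mp h2.symm).resolve_left hz.1
  have hall := AnalyticOnNhd.eqOn_zero_of_preconnected_of_frequently_eq_zero
    (U := (P.lattice : Set ℂ)ᶜ) han P.isPreconnected_compl_lattice haL hzero.frequently
  obtain ⟨z, hz, hzL, -⟩ := hne.exists
  exact hz (hall hzL)

end PeriodPair

lemma PeriodPair.extAnalyticAt_mul_zeta_sub (P : PeriodPair) (c p : ℂ) :
    ExtAnalyticAt (fun z ↦ c * P.zeta (z - p) - c / (z - p)) p := by
  have h1 : AnalyticAt ℂ (fun z ↦ P.zetaReg (z - p)) p :=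
    AnalyticAt.fun_comp (f := fun z ↦ z - p) (by simpa using P.analyticAt_zetaReg_zero)
      (by fun_prop)
  refine ⟨fun z ↦ c * P.zetaReg (z - p), by fun_prop, .of_forall fun z ↦ ?_⟩
  simp only [zeta]
  ring

lemma PeriodPair.analyticAt_mul_zeta_sub (P : PeriodPair) (c : ℂ) {p z : ℂ}
    (hz : z - p ∉ P.lattice) : AnalyticAt ℂ (fun z ↦ c * P.zeta (z - p)) z := by
  have h1 : AnalyticAt ℂ (fun z ↦ P.zeta (z - p)) z :=
    (P.analyticAt_zeta hz).fun_comp (f := fun z ↦ z - p) (by fun_prop)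
  fun_prop

/-- A periodic function with at worst simple poles, located at two points modulo the lattice,
is a linear combination of translated zeta functions with residues summing to zero. -/
lemma PeriodPair.exists_eq_zeta_sub_zeta (P : PeriodPair) {h : ℂ → ℂ} {α β : ℂ}
    (hαβ : α - β ∉ P.lattice)
    (hper : ∀ l ∈ P.lattice, ∀ z, z - α ∉ P.lattice → z - β ∉ P.lattice → h (z + l) = h z)
    (han : ∀ z, z - α ∉ P.lattice → z - β ∉ P.lattice → AnalyticAt ℂ h z)
    (hα : ExtAnalyticAt (fun z ↦ (z - α) * h z) α)
    (hβ : ExtAnalyticAt (fun z ↦ (z - β) * h z) β) :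
    ∃ c B : ℂ, ∀ z, z - α ∉ P.lattice → z - β ∉ P.lattice →
      h z = c * P.zeta (z - α) - c * P.zeta (z - β) + B := by
  have hβα : β - α ∉ P.lattice := by rwa [← neg_sub, neg_mem_iff]
  have hadd : ∀ {p z l}, l ∈ P.lattice → z - p ∉ P.lattice → z + l - p ∉ P.lattice := by
    intro p z l hl hz h
    refine hz ?_
    convert sub_mem h hl using 1
    ring
  obtain ⟨c, hc⟩ := hα.exists_residue
  obtain ⟨d, hd⟩ := hβ.exists_residue
  set F : ℂ → ℂ := fun z ↦ h z - c * P.zeta (z - α) - d * P.zeta (z - β) with hF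
  have hFα : ExtAnalyticAt F α := by
    have := (hc.sub (P.extAnalyticAt_mul_zeta_sub c α)).sub
      (P.analyticAt_mul_zeta_sub d hαβ).extAnalyticAt
    convert this using 2
    simp only [hF]
    ring
  have hFβ : ExtAnalyticAt F β := by
    have := (hd.sub (P.extAnalyticAt_mul_zeta_sub d β)).sub
      (P.analyticAt_mul_zeta_sub c hβα).extAnalyticAt
    convert this using 2
    simp only [hF]
    ring
  have hFan : ∀ z, z - α ∉ P.lattice → z - β ∉ P.lattice → AnalyticAt ℂ F z := fun z h1 h2 ↦
    ((han z h1 h2).sub (P.analyticAt_mul_zeta_sub c h1)).sub (P.analyticAt_mul_zeta_sub d h2)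
  have hFper : ∀ l ∈ P.lattice, ∀ η, (∀ z ∉ P.lattice, P.zeta (z + l) = P.zeta z + η) →
      ∀ z, z - α ∉ P.lattice → z - β ∉ P.lattice → F (z + l) = F z - (c + d) * η := by
    intro l hl η hη z h1 h2
    simp only [hF]
    rw [hper l hl z h1 h2, add_sub_right_comm, hη _ h1, add_sub_right_comm, hη _ h2]
    ring
  have htranslate : ∀ p q, p - q ∈ P.lattice → ExtAnalyticAt F q → ExtAnalyticAt F p := by
    intro p q hpq hq
    have hqp : q - p ∈ P.lattice := by rwa [← neg_sub, neg_mem_iff]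
    obtain ⟨η, hη⟩ := P.exists_zeta_add_coe ⟨_, hqp⟩
    have h1 : ExtAnalyticAt (fun z ↦ F (z + (q - p))) p :=
      ExtAnalyticAt.comp_add_const (by rwa [add_sub_cancel])
    refine (h1.sub (analyticAt_const (v := -((c + d) * η))).extAnalyticAt).congr ?_
    filter_upwards [P.eventually_sub_notMem_lattice α p, P.eventually_sub_notMem_lattice β p]
      with z h2 h3
    rw [hFper _ hqp η hη z h2 h3]
    ring
  obtain ⟨E, hE, hEF⟩ := exists_differentiable_of_extAnalyticAt (F := F) fun p ↦ by
    by_cases h1 : p - α ∈ P.lattice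
    · exact htranslate p α h1 hFα
    by_cases h2 : p - β ∈ P.lattice
    · exact htranslate p β h2 hFβ
    exact (hFan p h1 h2).extAnalyticAt
  replace hEF : ∀ z, z - α ∉ P.lattice → z - β ∉ P.lattice → E z = F z := fun z h1 h2 ↦
    hEF z (hFan z h1 h2).continuousAt
  have hEper : ∀ l ∈ P.lattice, ∀ η, (∀ z ∉ P.lattice, P.zeta (z + l) = P.zeta z + η) →
      ∀ z, E (z + l) = E z + -((c + d) * η) := by
    intro l hl η hη z
    have h1 : (fun z ↦ E (z + l)) =ᶠ[𝓝[≠] z] fun z ↦ E z + -((c + d) * η) := by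
      filter_upwards [P.eventually_sub_notMem_lattice α z, P.eventually_sub_notMem_lattice β z]
        with w h1 h2
      rw [hEF _ (hadd hl h1) (hadd hl h2), hEF w h1 h2, hFper l hl η hη w h1 h2, sub_eq_add_neg]
    have hc : ContinuousAt (fun z ↦ E (z + l)) z :=
      (hE.continuous.comp (continuous_add_const l)).continuousAt
    exact ((hc.eventuallyEq_nhds_iff_eventuallyEq_nhdsNE
      (hE.continuous.continuousAt.add_const _)).mp h1).self_of_nhds
  obtain ⟨K, B, hKB⟩ := P.exists_affine_of_quasiperiodic hE fun l hl ↦ by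
    obtain ⟨η, hη⟩ := P.exists_zeta_add_coe ⟨l, hl⟩
    exact ⟨_, hEper l hl η hη⟩
  have hK : ∀ l ∈ P.lattice, ∀ η, (∀ z ∉ P.lattice, P.zeta (z + l) = P.zeta z + η) →
      K * l = -((c + d) * η) := by
    intro l hl η hη
    have := hEper l hl η hη 0
    rw [hKB, hKB] at this
    linear_combination this
  have hcd : c + d = 0 := by
    refine P.eq_zero_of_zeta_add_linear_periodic (K := K) fun l hl z hz ↦ ?_
    obtain ⟨η, hη⟩ := P.exists_zeta_add_coe ⟨l, hl⟩
    have h1 := hη z hz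
    simp only at h1
    rw [h1]
    linear_combination hK l hl η hη
  have hK0 : K = 0 := by
    obtain ⟨η, hη⟩ := P.exists_zeta_add_coe ⟨_, P.ω₁_mem_lattice⟩
    have h1 := hK _ P.ω₁_mem_lattice η hη
    have h2 : P.ω₁ ≠ 0 := P.indep.ne_zero 0
    rw [hcd, zero_mul, neg_zero] at h1
    exact (mul_eq_zero.mp h1).resolve_right h2
  refine ⟨c, B, fun z h1 h2 ↦ ?_⟩
  have h3 := hEF z h1 h2
  rw [hKB, hK0] at h3
  simp only [hF] at h3
  linear_combination -h3 + P.zeta (z - β) * hcd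

lemma IsLattice.exists_periodPair {L : Set ℂ} (hL : IsLattice L) :
    ∃ P : PeriodPair, L = P.lattice := by
  obtain ⟨ω₁, ω₂, hω, rfl⟩ := hL
  refine ⟨⟨ω₁, ω₂, hω⟩, ?_⟩
  ext z
  simp [PeriodPair.mem_lattice, eq_comm]

theorem stmt14 (L : Set ℂ) (hL : IsLattice L) (s : ℂ)
    (hs : ∀ n : ℕ, 1 ≤ n → (n : ℂ) * s ∉ L)
    (α : ℂ) (h : ℂ → ℂ) (hh : IsElliptic L h)
    (hana : ∀ z : ℂ, (∀ lam ∈ L, z ≠ α + lam ∧ z ≠ α + s + lam) → AnalyticAt ℂ h z)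
    (hpole : ∀ β : ℂ, (∃ lam ∈ L, β = α + lam ∨ β = α + s + lam) →
      ExtAnalyticAt (fun z => (z - β) * h z) β) :
    EllSummable L s (deriv h) := by
  obtain ⟨P, rfl⟩ := hL.exists_periodPair
  have hsL : s ∉ P.lattice := by simpa using hs 1 le_rfl
  have han : ∀ z, z - α ∉ P.lattice → z - (α + s) ∉ P.lattice → AnalyticAt ℂ h z := by
    refine fun z h1 h2 ↦ hana z fun l hl ↦ ⟨?_, ?_⟩
    · rintro rfl
      exact h1 (by simpa using hl)
    · rintro rfl
      exact h2 (by simpa using hl)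
  obtain ⟨c, B, hcB⟩ := P.exists_eq_zeta_sub_zeta (h := h) (α := α) (β := α + s)
    (by simpa using hsL) (fun l hl z h1 h2 ↦ hh.2 l hl z (han z h1 h2)) han
    (hpole α ⟨0, zero_mem P.lattice, by simp⟩) (hpole (α + s) ⟨0, zero_mem P.lattice, by simp⟩)
  have hderiv : ∀ z, z - α ∉ P.lattice → z - (α + s) ∉ P.lattice →
      deriv h z = c * P.weierstrassP (z - (α + s)) - c * P.weierstrassP (z - α) := by
    intro z h1 h2
    have hev : ∀ p, z - p ∉ P.lattice → ∀ᶠ w in 𝓝 z, w - p ∉ P.lattice := fun p hp ↦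
      (continuous_sub_right p).continuousAt.eventually
        (P.isClosed_lattice.isOpen_compl.mem_nhds hp)
    have heq : h =ᶠ[𝓝 z] fun z ↦ c * P.zeta (z - α) - c * P.zeta (z - (α + s)) + B := by
      filter_upwards [hev _ h1, hev _ h2] with w h3 h4 using hcB w h3 h4
    rw [heq.deriv_eq]
    have h5 := ((((P.hasDerivAt_zeta h1).comp_sub_const z α).const_mul c).sub
      (((P.hasDerivAt_zeta h2).comp_sub_const z (α + s)).const_mul c)).add_const B
    refine h5.deriv.trans ?_
    ring
  by_cases hc : c = 0
  · refine ⟨fun _ ↦ 0, ⟨fun _ _ ↦ analyticAt_const.meromorphicAt, fun _ _ _ _ ↦ rfl⟩,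
      fun z _ _ ↦ ?_⟩
    rw [sub_zero]
    by_contra hne
    have hd : DifferentiableAt ℂ h z := differentiableAt_of_deriv_ne_zero hne
    have heq : h =ᶠ[𝓝[≠] z] fun _ ↦ B := by
      filter_upwards [P.eventually_sub_notMem_lattice α z,
        P.eventually_sub_notMem_lattice (α + s) z] with w h1 h2
      simp [hcB w h1 h2, hc]
    have heq' := (hd.continuousAt.eventuallyEq_nhds_iff_eventuallyEq_nhdsNE
      continuousAt_const).mp heq
    exact hne (by rw [heq'.deriv_eq, deriv_const])
  set g : ℂ → ℂ := fun z ↦ -c * P.weierstrassP (z - (α + s)) with hg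
  have hpolar : ∀ z, AnalyticAt ℂ g z → z - (α + s) ∉ P.lattice := by
    intro z hz hmem
    refine P.not_continuousAt_weierstrassP _ hmem ?_
    have h1 : ContinuousAt (fun w ↦ (-c)⁻¹ * g (w + (α + s))) (z - (α + s)) :=
      continuousAt_const.mul (ContinuousAt.comp (g := g) (by simpa using hz.continuousAt)
        (continuous_add_const (α + s)).continuousAt)
    convert h1 using 2 with w
    simp only [hg, add_sub_cancel_right]
    rw [inv_mul_cancel_left₀ (neg_ne_zero.mpr hc)]
  refine ⟨g, ⟨fun z _ ↦ ?_, fun l hl z _ ↦ ?_⟩, fun z h1 h2 ↦ ?_⟩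
  · exact (MeromorphicAt.const (-c) z).mul
      ((P.meromorphic_weierstrassP _).comp_analyticAt (g := fun z ↦ z - (α + s)) (by fun_prop))
  · simp only [hg]
    rw [add_sub_right_comm, P.weierstrassP_add_coe _ ⟨l, hl⟩]
  · have h3 := hpolar _ h2
    have h4 : z + s - (α + s) = z - α := by ring
    rw [h4] at h3
    rw [hderiv z h3 (hpolar _ h1)]
    simp only [hg, h4]
    ring
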